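/- arXiv:2604.23997 — 2 statements merged into one kernel-verified Lean document; each statement's English description precedes it below -/
import Mathlib

section
/- Let k be a field and f : X → Y a universally closed, quasi-separated morphism of schemes over k. Then there exists a factorization f = π ∘ f' through a scheme Y' such that π : Y' → Y is an integral morphism, and f' : X → Y' is universally closed, quasi-compact, quasi-separated and surjective, and the natural map O_{Y'} → f'_* O_X is an isomorphism. -/
/-!
Framework for formalizing statements of "The Birational Invariance of Fundamental
Group Schemes" (Li–Wang).

Mathlib provides the pushforward of sheaves of modules along a morphism of schemes,
but not yet the pullback `f^*`.  We therefore encode the pullback through its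
universal property: `PullbackData f M` is the data of a sheaf of modules `N` on the
source together with a unit morphism `M ⟶ f_* N` which represents the functor
`P ↦ Hom(M, f_* P)` (this is exactly the universal property coming from the
adjunction `f^* ⊣ f_*`, so such data is unique up to canonical isomorphism and the
genuine pullback provides one).  Statements are phrased by quantifying over all
such incarnations of the pullback.
-/

open CategoryTheory AlgebraicGeometry TopologicalSpace Opposite Limits

universe u

noncomputable section

variable {W X Y S : Scheme.{u}}

/-- A ring homomorphism between localizations away from `s` and `φ s` which lies over a bijective
ring homomorphism `φ` is bijective. -/
theorem IsLocalization.Away.bijective_of_bijective {A B A' B' : Type*} [CommRing A] [CommRing B]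
    [CommRing A'] [CommRing B'] [Algebra A A'] [Algebra B B'] (φ : A →+* B)
    (hφ : Function.Bijective φ) (s : A) [IsLocalization.Away s A'] [IsLocalization.Away (φ s) B']
    (ψ : A' →+* B') (h : ψ.comp (algebraMap A A') = (algebraMap B B').comp φ) :
    Function.Bijective ψ := by
  obtain rfl : IsLocalization.Away.map A' B' φ s = ψ :=
    IsLocalization.ringHom_ext (Submonoid.powers s)
      (by rw [h, IsLocalization.Away.map, IsLocalization.map_comp])
  refine ⟨(IsLocalization.Away.map_injective_iff _ _ _).mpr fun a ha ↦ ⟨0, ?_⟩,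
    (IsLocalization.Away.map_surjective_iff _ _ _ _).mpr fun b ↦ ?_⟩
  · simpa using hφ.1 (ha.trans (map_zero φ).symm)
  · obtain ⟨a, rfl⟩ := hφ.2 b
    exact ⟨a, 0, by simp⟩

namespace AlgebraicGeometry.Scheme.Hom

/-- For `f` quasi-compact and quasi-separated, `f.app` being an isomorphism on an affine open
implies the same on its basic opens. -/
theorem isIso_app_basicOpen {X Y : Scheme.{u}} (f : X ⟶ Y) [QuasiCompact f] [QuasiSeparated f]
    {V : Y.Opens} (hV : IsAffineOpen V) [IsIso (f.app V)] (s : Γ(Y, V)) :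
    IsIso (f.app (Y.basicOpen s)) := by
  have e : X.basicOpen (f.app V s) = f ⁻¹ᵁ Y.basicOpen s := (f.preimage_basicOpen s).symm
  refine @IsIso.of_isIso_comp_right _ _ _ _ _ _ (X.presheaf.map (eqToHom e).op) _ ?_
  rw [ConcreteCategory.isIso_iff_bijective]
  have := hV.isLocalization_basicOpen s
  have : IsLocalization.Away ((f.app V).hom s) Γ(X, X.basicOpen (f.app V s)) :=
    isLocalization_basicOpen_of_qcqs (f.isCompact_preimage hV.isCompact)
      (f.isQuasiSeparated_preimage hV.isQuasiSeparated) (f.app V s)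
  refine IsLocalization.Away.bijective_of_bijective (f.app V).hom
    ((ConcreteCategory.isIso_iff_bijective _).mp ‹_›) s _ ?_
  rw [RingHom.algebraMap_toAlgebra, RingHom.algebraMap_toAlgebra, ← CommRingCat.hom_comp,
    ← CommRingCat.hom_comp]
  simp [Scheme.Hom.app_eq_appLE, Scheme.Hom.appLE_map, Scheme.Hom.map_appLE]

/-- A universally closed morphism induces an integral ring homomorphism on the sections over every
affine open. -/
theorem isIntegral_app_of_universallyClosed {X Y : Scheme.{u}} (f : X ⟶ Y) [UniversallyClosed f]
    {U : Y.Opens} (hU : IsAffineOpen U) : (f.app U).hom.IsIntegral := by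
  have : IsAffine U := hU
  have h := isIntegral_appTop_of_universallyClosed (f ∣_ U)
  rw [← resLE_eq_morphismRestrict] at h
  have := RingHom.toMorphismProperty_respectsIso_iff.mp RingHom.isIntegral_respectsIso
  rw [app_eq_appLE]
  exact (MorphismProperty.arrow_mk_iso_iff (RingHom.toMorphismProperty RingHom.IsIntegral)
    (arrowResLEAppIso f U _ le_rfl)).mp h

/-- For a universally closed and quasi-separated morphism, the sections of the relative
normalization over the preimage of an affine open are all sections of the source. -/
theorem isIso_toNormalization_app_preimage {X Y : Scheme.{u}} (f : X ⟶ Y) [UniversallyClosed f]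
    [QuasiSeparated f] {U : Y.Opens} (hU : IsAffineOpen U) :
    IsIso (f.toNormalization.app (f.fromNormalization ⁻¹ᵁ U)) := by
  let := (f.app U).hom.toAlgebra
  have : IsIso (CommRingCat.ofHom (integralClosure Γ(Y, U) Γ(X, f ⁻¹ᵁ U)).val.toRingHom) := by
    rw [ConcreteCategory.isIso_iff_bijective]
    exact ⟨Subtype.val_injective, fun x ↦ ⟨⟨x, f.isIntegral_app_of_universallyClosed hU x⟩, rfl⟩⟩
  rw [f.toNormalization_app_preimage ⟨U, hU⟩]
  exact @IsIso.comp_isIso _ _ _ _ _ _ _ _ (@IsIso.comp_isIso _ _ _ _ _ _ _ this _)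

/-- For a universally closed and quasi-separated morphism, the structure sheaf of the relative
normalization is the pushforward of the structure sheaf of the source. -/
theorem isIso_c_toNormalization {X Y : Scheme.{u}} (f : X ⟶ Y) [UniversallyClosed f]
    [QuasiSeparated f] : IsIso f.toNormalization.c := by
  let B : (Σ U : Y.affineOpens, Γ(f.normalization, f.fromNormalization ⁻¹ᵁ U.1)) →
      f.normalization.Opens := fun i ↦ f.normalization.basicOpen i.2
  have hB : Opens.IsBasis (Set.range B) := by
    rw [Opens.isBasis_iff_nbhd]
    intro W x hx
    obtain ⟨_, ⟨U, hU, rfl⟩, hxU, -⟩ := Y.isBasis_affineOpens.exists_subset_of_mem_open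
      (Set.mem_univ (f.fromNormalization x)) isOpen_univ
    obtain ⟨s, hs, hxs⟩ := (hU.preimage f.fromNormalization).exists_basicOpen_le ⟨x, hx⟩ hxU
    exact ⟨_, ⟨⟨⟨U, hU⟩, s⟩, rfl⟩, hxs, hs⟩
  let φ : f.normalization.sheaf ⟶
      (TopCat.Sheaf.pushforward CommRingCat f.toNormalization.base).obj X.sheaf :=
    ⟨f.toNormalization.c⟩
  have : IsIso φ := TopCat.Sheaf.isIso_iff_isIso_basis hB fun i ↦
    have := f.isIso_toNormalization_app_preimage i.1.2
    f.toNormalization.isIso_app_basicOpen (i.1.2.preimage f.fromNormalization) i.2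
  exact inferInstanceAs (IsIso ((TopCat.Sheaf.forget _ _).map φ))

end AlgebraicGeometry.Scheme.Hom

/-- Let `k` be a field and `f : X ⟶ Y` a universally closed,
quasi-separated morphism of schemes over `k`.  Then `f` factors as `f = f' ≫ π`
through a scheme `Y'` such that `π : Y' ⟶ Y` is an integral morphism, `f'` is
universally closed, quasi-compact, quasi-separated and surjective, and the natural
map `𝒪_{Y'} ⟶ f'_* 𝒪_X` is an isomorphism. -/
theorem stein_type_factorization
    {k : Type u} [Field k] {X Y : Scheme.{u}}
    (pX : X ⟶ Spec (CommRingCat.of k)) (pY : Y ⟶ Spec (CommRingCat.of k))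
    (f : X ⟶ Y) (hcomp : f ≫ pY = pX)
    [UniversallyClosed f] [QuasiSeparated f] :
    ∃ (Y' : Scheme.{u}) (f' : X ⟶ Y') (π : Y' ⟶ Y),
      f' ≫ π = f ∧ IsIntegralHom π ∧
      UniversallyClosed f' ∧ QuasiCompact f' ∧ QuasiSeparated f' ∧
      Surjective f' ∧ IsIso f'.c := by
  have : UniversallyClosed (f.toNormalization ≫ f.fromNormalization) := by simpa
  have : QuasiSeparated (f.toNormalization ≫ f.fromNormalization) := by simpa
  exact ⟨f.normalization, f.toNormalization, f.fromNormalization,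
    f.toNormalization_fromNormalization, inferInstance, inferInstance, inferInstance,
    inferInstance, inferInstance, f.isIso_c_toNormalization⟩
end
end

section
/- Let k be a field and f : X → Y a birational morphism of integral schemes that are proper over k, with Y normal. Then the natural map O_Y → f_* O_X is an isomorphism of sheaves of rings. -/
/-!
Framework for formalizing statements of "The Birational Invariance of Fundamental
Group Schemes" (Li–Wang).

Mathlib provides the pushforward of sheaves of modules along a morphism of schemes,
but not yet the pullback `f^*`.  We therefore encode the pullback through its
universal property: `PullbackData f M` is the data of a sheaf of modules `N` on the
source together with a unit morphism `M ⟶ f_* N` which represents the functor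
`P ↦ Hom(M, f_* P)` (this is exactly the universal property coming from the
adjunction `f^* ⊣ f_*`, so such data is unique up to canonical isomorphism and the
genuine pullback provides one).  Statements are phrased by quantifying over all
such incarnations of the pullback.
-/

open CategoryTheory AlgebraicGeometry TopologicalSpace Opposite Limits

universe u

noncomputable section

variable {W X Y S : Scheme.{u}}

/-- A morphism of schemes is *birational* if it induces a bijection between the sets of
generic points of irreducible components, and for every generic point `η` of an
irreducible component of the source the induced local ring map
`𝒪_{Y, f(η)} ⟶ 𝒪_{X, η}` is an isomorphism. -/
def IsBirational (f : X ⟶ Y) : Prop :=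
  Set.BijOn f.base (genericPoints X) (genericPoints Y) ∧
    ∀ x ∈ genericPoints X, IsIso (f.stalkMap x)

/-- A scheme is *normal* if all of its local rings are integrally closed domains. -/
def IsNormalScheme (X : Scheme.{u}) : Prop :=
  ∀ x : X, IsDomain (X.presheaf.stalk x) ∧ IsIntegrallyClosed (X.presheaf.stalk x)

/-- A normal scheme has integrally closed section rings over its nonempty affine opens. -/
lemma isIntegrallyClosed_of_isAffineOpen [IsIntegral Y] (hY : IsNormalScheme Y) {U : Y.Opens}
    (hU : IsAffineOpen U) [Nonempty U] : IsIntegrallyClosed Γ(Y, U) := by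
  refine .of_localization_maximal fun p _ hp ↦ ?_
  let y : PrimeSpectrum Γ(Y, U) := ⟨p, hp.isPrime⟩
  have hy : hU.fromSpec y ∈ U := (hU.isoSpec.inv y).2
  let _ : Algebra Γ(Y, U) (Y.presheaf.stalk (hU.fromSpec y)) :=
    TopCat.Presheaf.algebra_section_stalk Y.presheaf ⟨hU.fromSpec y, hy⟩
  have : IsLocalization.AtPrime (Y.presheaf.stalk (hU.fromSpec y)) p :=
    hU.isLocalization_stalk' y hy
  have := (hY (hU.fromSpec y)).2
  exact .of_equiv (IsLocalization.algEquiv p.primeCompl (Y.presheaf.stalk (hU.fromSpec y))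
    (Localization.AtPrime p)).toRingEquiv

/-- On a normal integral scheme, a rational function integral over the sections on an affine open
is regular there. -/
lemma exists_germ_eq_of_isIntegralElem [IsIntegral Y] (hY : IsNormalScheme Y) {U : Y.Opens}
    (hU : IsAffineOpen U) {y : Y} (hy : y = genericPoint Y) (hyU : y ∈ U)
    {t : Y.presheaf.stalk y} (ht : (Y.presheaf.germ U y hyU).hom.IsIntegralElem t) :
    ∃ r, Y.presheaf.germ U y hyU r = t := by
  subst hy
  have : Nonempty U := ⟨⟨_, hyU⟩⟩
  have := functionField_isFractionRing_of_isAffineOpen Y U hU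
  exact (isIntegrallyClosed_iff Y.functionField).mp
    (isIntegrallyClosed_of_isAffineOpen hY hU) ht

lemma isIntegral_app_of_universallyClosed (f : X ⟶ Y) [UniversallyClosed f] {U : Y.Opens}
    (hU : IsAffineOpen U) : (f.app U).hom.IsIntegral := by
  have : IsAffine U := hU
  have h := isIntegral_appTop_of_universallyClosed (f ∣_ U)
  rw [morphismRestrict_appTop] at h
  have key : (f.app (U.ι ''ᵁ ⊤)).hom.IsIntegral := by
    let φ := X.presheaf.map (eqToHom (image_morphismRestrict_preimage f U ⊤)).op
    have e : f.app (U.ι ''ᵁ ⊤) = (f.app (U.ι ''ᵁ ⊤) ≫ φ) ≫ inv φ :=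
      (IsIso.eq_comp_inv φ).mpr rfl
    rw [e, CommRingCat.hom_comp]
    exact RingHom.IsIntegral.trans _ _ h
      (RingHom.isIntegral_of_surjective _
        (ConcreteCategory.bijective_of_isIso (inv φ)).surjective)
  rwa [U.ι_image_top] at key

/-- Let `k` be a field and `f : X ⟶ Y` a birational morphism of
integral schemes proper over `k` with `Y` normal.  Then the natural map
`𝒪_Y ⟶ f_* 𝒪_X` is an isomorphism. -/
theorem pushforward_structure_sheaf_iso_of_birational
    {k : Type u} [Field k] {X Y : Scheme.{u}}
    (pX : X ⟶ Spec (CommRingCat.of k)) (pY : Y ⟶ Spec (CommRingCat.of k))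
    [IsProper pX] [IsProper pY] [IsIntegral X] [IsIntegral Y]
    (f : X ⟶ Y) (hcomp : f ≫ pY = pX)
    (hbir : IsBirational f) (hY : IsNormalScheme Y) :
    IsIso f.c := by
  have : IsProper (f ≫ pY) := hcomp ▸ ‹IsProper pX›
  have : IsProper f := .of_comp f pY
  have hη : genericPoint X ∈ genericPoints X := by
    simp [genericPoints, irreducibleComponents_eq_singleton]
  have := hbir.2 _ hη
  have hfη : f (genericPoint X) = genericPoint Y := by
    have h : closure {f (genericPoint X)} ∈ irreducibleComponents Y := hbir.1.mapsTo hη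
    rw [irreducibleComponents_eq_singleton] at h
    exact IsGenericPoint.eq h (genericPoint_spec Y)
  have hbij := ConcreteCategory.bijective_of_isIso (f.stalkMap (genericPoint X))
  let φ : Y.sheaf ⟶ (TopCat.Sheaf.pushforward _ f.base).obj X.sheaf := ⟨f.c⟩
  suffices IsIso φ from Functor.map_isIso (TopCat.Sheaf.forget CommRingCat Y) φ
  refine TopCat.Sheaf.isIso_iff_isIso_basis (B := fun U : Y.affineOpens ↦ U.1)
    (by simpa using Y.isBasis_affineOpens) fun ⟨U, hU⟩ ↦ ?_
  change IsIso (f.app U)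
  obtain rfl | hne := eq_or_ne U ⊥
  · have : Subsingleton Γ(X, f ⁻¹ᵁ ⊥) := inferInstanceAs (Subsingleton Γ(X, ⊥))
    exact (ConcreteCategory.isIso_iff_bijective _).mpr
      ⟨Function.injective_of_subsingleton _, Function.surjective_to_subsingleton _⟩
  have hyU : f (genericPoint X) ∈ U := by
    rw [hfη]
    refine ((genericPoint_spec Y).mem_open_set_iff U.isOpen).mpr ?_
    rwa [Set.univ_inter, ← Opens.ne_bot_iff_nonempty]
  refine (ConcreteCategory.isIso_iff_bijective _).mpr ⟨fun a b hab ↦ ?_, fun s ↦ ?_⟩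
  · apply germ_injective_of_isIntegral Y _ hyU
    apply hbij.injective
    rw [Scheme.Hom.germ_stalkMap_apply, Scheme.Hom.germ_stalkMap_apply, hab]
  · obtain ⟨t, ht⟩ := hbij.surjective (X.presheaf.germ (f ⁻¹ᵁ U) _ hyU s)
    obtain ⟨p, hp, hps⟩ := isIntegral_app_of_universallyClosed f hU s
    obtain ⟨r, rfl⟩ := exists_germ_eq_of_isIntegralElem hY hU hfη hyU (t := t) <| by
      refine ⟨p, hp, hbij.injective ?_⟩
      have hg := congrArg CommRingCat.Hom.hom
        (Scheme.Hom.germ_stalkMap f U (genericPoint X) hyU)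
      rw [CommRingCat.hom_comp, CommRingCat.hom_comp] at hg
      erw [Polynomial.hom_eval₂, hg, ht, ← Polynomial.hom_eval₂, hps]
      simp
    refine ⟨r, germ_injective_of_isIntegral X _ hyU ?_⟩
    rw [← ht, Scheme.Hom.germ_stalkMap_apply]
end
end
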